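/- Let p be a prime number, k > 1 a natural number, and N = p^k. Let R be a real N×N matrix (rows and columns indexed by 1,…,N) satisfying, for every m ∈ {0, 1, …, k−1}, every i of the form i = r + s·p^m with 1 ≤ r ≤ p^m and 0 ≤ s ≤ p^{k−m} − 2, every l ∈ {1, …, p^{k−m−1}}, and every t ∈ {0, 1, …, p−1}, the constraint R_{i,l} − R_{i+p^m, l} = R_{i, l + t·p^{k−m−1}} − R_{i+p^m, l + t·p^{k−m−1}}. Then the N×N matrix H with entries H_{a,b} = (1/√N)·exp(2πi(a−1)(b−1)/N)·exp(i·R_{a,b}) is unitary (hence a unitary complex Hadamard matrix, since all its entries have modulus 1/√N). Moreover, the real vector space of matrices R satisfying all these constraints together with the dephasing conditions R_{1,j} = 0 for all j and R_{i,1} = 0 for all i has dimension p^{k−1}·((p−1)k − p) + 1, which equals d(F_{p^k}). -/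

import Mathlib

open Matrix ComplexConjugate

noncomputable section

/-- The real vector space `S(U)` of real `N×N` matrices `R` such that for all `i < j`,
`∑ k, U i k * conj (U j k) * (R i k - R j k) = 0`. -/
def defectSpace {N : ℕ} (U : Matrix (Fin N) (Fin N) ℂ) :
    Submodule ℝ (Matrix (Fin N) (Fin N) ℝ) where
  carrier := {R | ∀ i j : Fin N, i < j →
    ∑ k, U i k * conj (U j k) * ((R i k : ℂ) - (R j k : ℂ)) = 0}
  zero_mem' := by
    intro i j hij
    simp
  add_mem' := by
    intro R R' hR hR' i j hij
    have h1 := hR i j hij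
    have h2 := hR' i j hij
    have key : ∀ k, U i k * conj (U j k) * (((R + R') i k : ℂ) - ((R + R') j k : ℂ))
        = U i k * conj (U j k) * ((R i k : ℂ) - (R j k : ℂ))
          + U i k * conj (U j k) * ((R' i k : ℂ) - (R' j k : ℂ)) := by
      intro k
      simp only [Matrix.add_apply]
      push_cast
      ring
    rw [Finset.sum_congr rfl fun k _ => key k, Finset.sum_add_distrib, h1, h2, add_zero]
  smul_mem' := by
    intro c R hR i j hij
    have h1 := hR i j hij
    have key : ∀ k, U i k * conj (U j k) * (((c • R) i k : ℂ) - ((c • R) j k : ℂ))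
        = (c : ℂ) * (U i k * conj (U j k) * ((R i k : ℂ) - (R j k : ℂ))) := by
      intro k
      simp only [Matrix.smul_apply, smul_eq_mul]
      push_cast
      ring
    rw [Finset.sum_congr rfl fun k _ => key k, ← Finset.mul_sum, h1, mul_zero]

/-- The defect of a unitary matrix `U`: `d(U) = dim_ℝ S(U) - (2N - 1)`. -/
def defect {N : ℕ} (U : Matrix (Fin N) (Fin N) ℂ) : ℕ :=
  Module.finrank ℝ (defectSpace U) - (2 * N - 1)

/-- The Fourier matrix `F_N`, with entries `exp(2πi(i-1)(j-1)/N)/√N` (0-based indexing). -/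
def fourierMatrix (N : ℕ) : Matrix (Fin N) (Fin N) ℂ :=
  Matrix.of fun i j : Fin N =>
    Complex.exp (2 * Real.pi * Complex.I * (i : ℕ) * (j : ℕ) / N) / (Real.sqrt N : ℝ)

/-- The cycle constraints on a real `p^k × p^k` matrix `R` (0-based indexing): for every
`m < k`, every `t < p`, and all indices `i, i' = i + p^m`, `l < p^{k-m-1}`,
`l' = l + t·p^{k-m-1}`, one has `R_{i,l} - R_{i',l} = R_{i,l'} - R_{i',l'}`. -/
def cycleConstraint (p k : ℕ) (R : Matrix (Fin (p ^ k)) (Fin (p ^ k)) ℝ) : Prop :=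
  ∀ m : ℕ, m < k → ∀ t : ℕ, t < p → ∀ i i' l l' : Fin (p ^ k),
    (i' : ℕ) = (i : ℕ) + p ^ m → (l : ℕ) < p ^ (k - m - 1) →
    (l' : ℕ) = (l : ℕ) + t * p ^ (k - m - 1) →
    R i l - R i' l = R i l' - R i' l'

/-- The real vector space of matrices `R` satisfying the cycle constraints together with
the dephasing conditions (vanishing first row and first column). -/
def cycleSpace (p k : ℕ) : Submodule ℝ (Matrix (Fin (p ^ k)) (Fin (p ^ k)) ℝ) where
  carrier := {R | cycleConstraint p k R ∧
    ∀ i j : Fin (p ^ k), ((i : ℕ) = 0 ∨ (j : ℕ) = 0) → R i j = 0}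
  zero_mem' := by
    refine ⟨?_, ?_⟩
    · intro m hm t ht i i' l l' hi hl hl'
      simp
    · intro i j _
      simp
  add_mem' := by
    rintro R R' ⟨hR, hR0⟩ ⟨hR', hR'0⟩
    refine ⟨?_, ?_⟩
    · intro m hm t ht i i' l l' hi hl hl'
      have h1 := hR m hm t ht i i' l l' hi hl hl'
      have h2 := hR' m hm t ht i i' l l' hi hl hl'
      simp only [Matrix.add_apply]
      linarith
    · intro i j hij
      simp [Matrix.add_apply, hR0 i j hij, hR'0 i j hij]
  smul_mem' := by
    rintro c R ⟨hR, hR0⟩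
    refine ⟨?_, ?_⟩
    · intro m hm t ht i i' l l' hi hl hl'
      have h1 := hR m hm t ht i i' l l' hi hl hl'
      simp only [Matrix.smul_apply, smul_eq_mul]
      linear_combination c * h1
    · intro i j hij
      simp [Matrix.smul_apply, hR0 i j hij]

/-- Differences of rows congruent modulo `p ^ m` are periodic with period `p ^ (k - m - 1)`. -/
def HasPeriodicRowDiffs (p k : ℕ) (R : Matrix (Fin (p ^ k)) (Fin (p ^ k)) ℝ) : Prop :=
  ∀ m < k, ∀ i j l l' : Fin (p ^ k), (i : ℕ) ≡ j [MOD p ^ m] →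
    (l : ℕ) ≡ l' [MOD p ^ (k - m - 1)] → R i l - R j l = R i l' - R j l'

theorem HasPeriodicRowDiffs.cycleConstraint {p k : ℕ} {R : Matrix (Fin (p ^ k)) (Fin (p ^ k)) ℝ}
    (hR : HasPeriodicRowDiffs p k R) : cycleConstraint p k R := by
  intro m hm t _ i i' l l' hi _ hl'
  refine hR m hm i i' l l' ?_ ?_
  · simp [Nat.ModEq, hi]
  · simp [Nat.ModEq, hl']

theorem cycleConstraint.sub_eq_sub_of_modEq {p k : ℕ} (hp : 0 < p)
    {R : Matrix (Fin (p ^ k)) (Fin (p ^ k)) ℝ} (hR : cycleConstraint p k R) {m : ℕ} (hm : m < k)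
    (hdiff : ∀ i i' l l' : Fin (p ^ k), (i' : ℕ) = i + p ^ m →
      (l : ℕ) ≡ l' [MOD p ^ (k - m)] → R i l - R i' l = R i l' - R i' l')
    {i j l l' : Fin (p ^ k)} (hij : (i : ℕ) ≡ j [MOD p ^ m])
    (hl : (l : ℕ) ≡ l' [MOD p ^ (k - m - 1)]) : R i l - R j l = R i l' - R j l' := by
  set q := p ^ (k - m - 1) with hq
  have hq0 : 0 < q := by positivity
  have hqp : p ^ (k - m) = q * p := by
    rw [hq, ← pow_succ]; congr 1; omega
  have hstep : ∀ i i' l l' : Fin (p ^ k), (i' : ℕ) = i + p ^ m → (l : ℕ) ≡ l' [MOD q] →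
      R i l - R i' l = R i l' - R i' l' := by
    have hred : ∀ i i' l l₀ : Fin (p ^ k), (i' : ℕ) = i + p ^ m → (l₀ : ℕ) = l % q →
        R i l₀ - R i' l₀ = R i l - R i' l := by
      intro i i' l l₀ hi hl₀
      let l₁ : Fin (p ^ k) := ⟨l % (q * p), (Nat.mod_le _ _).trans_lt l.2⟩
      have h₁ : R i l₁ - R i' l₁ = R i l - R i' l := by
        refine hdiff i i' l₁ l hi ?_
        rw [hqp]
        exact Nat.mod_modEq _ _
      rw [← h₁]
      refine hR m hm (l / q % p) (Nat.mod_lt _ hp) i i' l₀ l₁ hi ?_ ?_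
      · rw [hl₀]; exact Nat.mod_lt _ hq0
      · rw [hl₀]
        change (l : ℕ) % (q * p) = _
        rw [Nat.mod_mul, ← hq, mul_comm]
    intro i i' l l' hi hll
    let l₀ : Fin (p ^ k) := ⟨l % q, (Nat.mod_le _ _).trans_lt l.2⟩
    rw [← hred i i' l l₀ hi rfl, ← hred i i' l' l₀ hi hll]
  have hbase : ∀ (s : ℕ) (r i : Fin (p ^ k)), (i : ℕ) = r + s * p ^ m →
      R i l - R r l = R i l' - R r l' := by
    intro s
    induction s with
    | zero =>
      intro r i hi
      have : i = r := Fin.ext (by simpa using hi)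
      simp [this]
    | succ s ih =>
      intro r i hi
      have hi' : (i : ℕ) = (r + s * p ^ m) + p ^ m := by rw [hi]; ring
      let i₀ : Fin (p ^ k) := ⟨r + s * p ^ m, by have := i.2; omega⟩
      have h₁ := ih r i₀ rfl
      have h₂ := hstep i₀ i l l' hi' hl
      linarith
  let r : Fin (p ^ k) := ⟨i % p ^ m, (Nat.mod_le _ _).trans_lt i.2⟩
  have hi := hbase (i / p ^ m) r i (Nat.mod_add_div' _ _).symm
  have hj := hbase (j / p ^ m) r j (by
    change (j : ℕ) = i % p ^ m + _
    rw [hij]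
    exact (Nat.mod_add_div' _ _).symm)
  linarith

theorem cycleConstraint.hasPeriodicRowDiffs {p k : ℕ} (hp : 0 < p)
    {R : Matrix (Fin (p ^ k)) (Fin (p ^ k)) ℝ} (hR : cycleConstraint p k R) :
    HasPeriodicRowDiffs p k R := by
  intro m
  induction m with
  | zero =>
    intro hm i j l l'
    refine hR.sub_eq_sub_of_modEq hp hm ?_
    intro i i' l l' _ hl
    have : l = l' := Fin.ext (Nat.ModEq.eq_of_lt_of_lt hl l.2 l'.2)
    rw [this]
  | succ m ih =>
    intro hm i j l l'
    refine hR.sub_eq_sub_of_modEq hp hm ?_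
    intro i i' l l' hi hl
    refine ih (by omega) i i' l l' ?_ ?_
    · simp [Nat.ModEq, hi, pow_succ]
    · rwa [Nat.sub_sub]

theorem cycleConstraint_iff_hasPeriodicRowDiffs {p k : ℕ} (hp : 0 < p)
    {R : Matrix (Fin (p ^ k)) (Fin (p ^ k)) ℝ} :
    cycleConstraint p k R ↔ HasPeriodicRowDiffs p k R :=
  ⟨fun h => h.hasPeriodicRowDiffs hp, fun h => h.cycleConstraint⟩

/-- The number of leading entries of row `i` that can be prescribed freely. -/
def freeLength (p k i : ℕ) : ℕ :=
  if i = 0 then p ^ k else p ^ (k - Nat.log p i - 1)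

theorem freeLength_pos {p : ℕ} (hp : 0 < p) (k i : ℕ) : 0 < freeLength p k i := by
  unfold freeLength
  split_ifs <;> positivity

theorem mod_pow_log_lt {p i : ℕ} (hp : 0 < p) (hi : i ≠ 0) : i % p ^ Nat.log p i < i :=
  (Nat.mod_lt _ (by positivity)).trans_le (Nat.pow_log_le_self p hi)

theorem HasPeriodicRowDiffs.eq_zero {p k : ℕ} (hp : 1 < p)
    {R : Matrix (Fin (p ^ k)) (Fin (p ^ k)) ℝ} (hR : HasPeriodicRowDiffs p k R)
    (h0 : ∀ i l : Fin (p ^ k), (l : ℕ) < freeLength p k i → R i l = 0) : R = 0 := by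
  have key : ∀ (n : ℕ) (i l : Fin (p ^ k)), (i : ℕ) = n → R i l = 0 := by
    intro n
    induction n using Nat.strong_induction_on with
    | _ n ih =>
      intro i l hi
      by_cases hn : n = 0
      · exact h0 i l (by simp [freeLength, hi, hn])
      · have hi0 : (i : ℕ) ≠ 0 := hi ▸ hn
        have hlt := mod_pow_log_lt (by omega : 0 < p) hi0
        let i₀ : Fin (p ^ k) := ⟨i % p ^ Nat.log p i, hlt.trans i.2⟩
        let l₀ : Fin (p ^ k) := ⟨l % freeLength p k i, (Nat.mod_le _ _).trans_lt l.2⟩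
        have h := hR (Nat.log p i) (Nat.log_lt_of_lt_pow hi0 i.2) i i₀ l l₀
          (Nat.mod_modEq _ _).symm (by
            have : freeLength p k i = p ^ (k - Nat.log p i - 1) := by simp [freeLength, hi0]
            rw [← this]
            exact (Nat.mod_modEq _ _).symm)
        have h₁ : R i l₀ = 0 := h0 i l₀ (Nat.mod_lt _ (freeLength_pos (by omega) k i))
        have h₂ := ih (i₀ : ℕ) (hi ▸ hlt) i₀ l rfl
        have h₃ := ih (i₀ : ℕ) (hi ▸ hlt) i₀ l₀ rfl
        linarith
  ext i l
  exact key i i l rfl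

/-- The rows with periodic differences whose leading free entries are prescribed by `f`. -/
def extendRows (p k : ℕ) (hp : 0 < p) (f : ℕ → ℕ → ℝ) (i l : ℕ) : ℝ :=
  if _h : i = 0 then f 0 l
  else
    extendRows p k hp f (i % p ^ Nat.log p i) l + f i (l % freeLength p k i) -
      extendRows p k hp f (i % p ^ Nat.log p i) (l % freeLength p k i)
termination_by i
decreasing_by all_goals exact mod_pow_log_lt hp ‹_›

theorem extendRows_eq {p k : ℕ} (hp : 0 < p) (f : ℕ → ℕ → ℝ) {i l : ℕ}
    (hl : l < freeLength p k i) : extendRows p k hp f i l = f i l := by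
  rw [extendRows]
  split_ifs with h
  · rw [h]
  · rw [Nat.mod_eq_of_lt hl]; ring

theorem extendRows_sub_mod {p k : ℕ} (hp : 1 < p) (f : ℕ → ℕ → ℝ) {m : ℕ} (i : ℕ)
    {l l' : ℕ} (hl : l ≡ l' [MOD p ^ (k - m - 1)]) :
    extendRows p k (by omega) f i l - extendRows p k (by omega) f (i % p ^ m) l =
      extendRows p k (by omega) f i l' - extendRows p k (by omega) f (i % p ^ m) l' := by
  induction i using Nat.strong_induction_on with
  | _ i ih =>
    by_cases him : i < p ^ m
    · simp [Nat.mod_eq_of_lt him]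
    · push Not at him
      have hi0 : i ≠ 0 := by
        have : 0 < p ^ m := by positivity
        omega
      have hm : m ≤ Nat.log p i := Nat.le_log_of_pow_le hp him
      have hl' : l % freeLength p k i = l' % freeLength p k i := by
        simp only [freeLength, hi0, if_false]
        exact hl.of_dvd (pow_dvd_pow p (by omega))
      have h := ih _ (mod_pow_log_lt (by omega : 0 < p) hi0)
      rw [Nat.mod_mod_of_dvd _ (pow_dvd_pow p hm)] at h
      have e : ∀ l, extendRows p k (by omega) f i l =
          extendRows p k (by omega) f (i % p ^ Nat.log p i) l + f i (l % freeLength p k i) -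
          extendRows p k (by omega) f (i % p ^ Nat.log p i) (l % freeLength p k i) := by
        intro l
        rw [extendRows, dif_neg hi0]
      rw [e l, e l', hl']
      linarith

theorem exists_hasPeriodicRowDiffs_extending {p : ℕ} (hp : 1 < p) (k : ℕ) (f : ℕ → ℕ → ℝ) :
    ∃ R : Matrix (Fin (p ^ k)) (Fin (p ^ k)) ℝ, HasPeriodicRowDiffs p k R ∧
      ∀ i l : Fin (p ^ k), (l : ℕ) < freeLength p k i → R i l = f i l := by
  refine ⟨fun i l => extendRows p k (by omega) f i l, ?_, fun i l h => extendRows_eq _ f h⟩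
  intro m _ i j l l' hij hl
  have hi := extendRows_sub_mod hp f (i : ℕ) hl
  have hj := extendRows_sub_mod hp f (j : ℕ) hl
  rw [← hij] at hj
  linarith

/-- A space of matrices whose elements are uniquely and freely determined by their entries in the
positions `s` has dimension `#s`. -/
theorem finrank_eq_card_of_existsUnique_entries {ι κ : Type*} [Fintype ι] [Fintype κ]
    (W : Submodule ℝ (Matrix ι κ ℝ)) (s : Finset (ι × κ))
    (hinj : ∀ R ∈ W, (∀ x ∈ s, R x.1 x.2 = 0) → R = 0)
    (hsurj : ∀ f : ι × κ → ℝ, ∃ R ∈ W, ∀ x ∈ s, R x.1 x.2 = f x) :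
    Module.finrank ℝ W = s.card := by
  classical
  let e : W →ₗ[ℝ] (s → ℝ) :=
    { toFun := fun R x => R.1 x.1.1 x.1.2
      map_add' := fun _ _ => rfl
      map_smul' := fun _ _ => rfl }
  have he : Function.Bijective e := by
    constructor
    · rw [injective_iff_map_eq_zero]
      intro R hR
      exact Subtype.ext (hinj R R.2 fun x hx => congrFun hR ⟨x, hx⟩)
    · intro g
      obtain ⟨R, hR, h⟩ := hsurj fun x => if hx : x ∈ s then g ⟨x, hx⟩ else 0
      refine ⟨⟨R, hR⟩, funext fun x => ?_⟩
      exact (h x.1 x.2).trans (by simp)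
  rw [(LinearEquiv.ofBijective e he).finrank_eq, Module.finrank_fintype_fun_eq_card,
    Fintype.card_coe]

/-- The positions of the freely prescribable entries. -/
def freePositions (p k : ℕ) : Finset (Fin (p ^ k) × Fin (p ^ k)) :=
  {x | (x.2 : ℕ) < freeLength p k x.1}

/-- The positions in the first row or in the first column. -/
def borderPositions (N : ℕ) : Finset (Fin N × Fin N) :=
  {x | (x.1 : ℕ) = 0 ∨ (x.2 : ℕ) = 0}

theorem card_borderPositions (N : ℕ) : (borderPositions N).card = 2 * N - 1 := by
  cases N with
  | zero => rfl
  | succ n =>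
    have h : borderPositions (n + 1) =
        (({0} : Finset (Fin (n + 1))) ×ˢ Finset.univ) ∪
          ((Finset.univ.erase 0) ×ˢ ({0} : Finset (Fin (n + 1)))) := by
      ext ⟨a, b⟩
      simp only [borderPositions, Finset.mem_filter, Finset.mem_univ, true_and, Finset.mem_union,
        Finset.mem_product, Finset.mem_singleton, Finset.mem_erase, Fin.ext_iff, Fin.val_zero]
      simp only [Fin.ext_iff, Fin.val_zero, ne_eq]
      tauto
    rw [h, Finset.card_union_of_disjoint]
    · simp
      omega
    · rw [Finset.disjoint_left]
      rintro ⟨a, b⟩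
      simp +contextual [eq_comm]

theorem borderPositions_subset_freePositions {p : ℕ} (hp : 0 < p) (k : ℕ) :
    borderPositions (p ^ k) ⊆ freePositions p k := by
  rintro ⟨a, b⟩ h
  simp only [borderPositions, freePositions, Finset.mem_filter, Finset.mem_univ, true_and] at h ⊢
  rcases h with h | h
  · simp [freeLength, h]
  · rw [h]; exact freeLength_pos hp k a

theorem sum_pow_sub_log {p : ℕ} (hp : 1 < p) (k : ℕ) {n : ℕ} (hn : n ≤ k) :
    ∑ i ∈ Finset.Ico 1 (p ^ n), p ^ (k - Nat.log p i - 1) = n * ((p - 1) * p ^ (k - 1)) := by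
  induction n with
  | zero => simp
  | succ n ih =>
    rw [← Finset.sum_Ico_consecutive _ (Nat.one_le_pow n p (by omega))
      (Nat.pow_le_pow_right (by omega) n.le_succ), ih (by omega)]
    have h : ∑ i ∈ Finset.Ico (p ^ n) (p ^ (n + 1)), p ^ (k - Nat.log p i - 1) =
        ∑ i ∈ Finset.Ico (p ^ n) (p ^ (n + 1)), p ^ (k - n - 1) := by
      refine Finset.sum_congr rfl fun i hi => ?_
      rw [Finset.mem_Ico] at hi
      rw [Nat.log_eq_of_pow_le_of_lt_pow hi.1 hi.2]
    have hpow : p ^ (k - 1) = p ^ n * p ^ (k - n - 1) := by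
      rw [← pow_add]; congr 1; omega
    have hsub : p ^ (n + 1) - p ^ n = p ^ n * (p - 1) := by
      rw [pow_succ, Nat.mul_sub, mul_one]
    rw [h, Finset.sum_const, Nat.card_Ico, smul_eq_mul, hsub, hpow]
    ring

theorem card_freePositions {p : ℕ} (hp : 1 < p) (k : ℕ) :
    (freePositions p k).card = p ^ k + k * ((p - 1) * p ^ (k - 1)) := by
  have hfree : ∀ i < p ^ k, freeLength p k i ≤ p ^ k := by
    intro i _
    unfold freeLength
    split_ifs
    · exact le_rfl
    · exact Nat.pow_le_pow_right (by omega) (by omega)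
  have h₁ : (freePositions p k).card = ∑ i : Fin (p ^ k), freeLength p k i := by
    rw [freePositions, ← Finset.univ_product_univ, Finset.card_filter, Finset.sum_product]
    refine Finset.sum_congr rfl fun i _ => ?_
    rw [← Finset.card_filter]
    exact Fin.card_filter_val_lt.trans (min_eq_right (hfree i i.2))
  rw [h₁, Fin.sum_univ_eq_sum_range (freeLength p k), Finset.range_eq_Ico,
    Finset.sum_eq_sum_Ico_succ_bot (by positivity), ← sum_pow_sub_log hp k le_rfl]
  congr 1
  refine Finset.sum_congr rfl fun i hi => ?_
  rw [Finset.mem_Ico] at hi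
  rw [freeLength, if_neg (by omega)]

theorem finrank_eq_card_freePositions {p k : ℕ} (hp : 1 < p)
    (W : Submodule ℝ (Matrix (Fin (p ^ k)) (Fin (p ^ k)) ℝ))
    (hW : ∀ R, R ∈ W ↔ HasPeriodicRowDiffs p k R) :
    Module.finrank ℝ W = (freePositions p k).card := by
  refine finrank_eq_card_of_existsUnique_entries W _ ?_ ?_
  · intro R hR h
    exact ((hW R).1 hR).eq_zero hp fun i l hl => h (i, l) (by simpa [freePositions] using hl)
  · intro f
    obtain ⟨R, hR, h⟩ := exists_hasPeriodicRowDiffs_extending hp k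
      (fun i l => if hx : i < p ^ k ∧ l < p ^ k then f (⟨i, hx.1⟩, ⟨l, hx.2⟩) else 0)
    refine ⟨R, (hW R).2 hR, fun x hx => ?_⟩
    rw [h _ _ (by simpa [freePositions] using hx)]
    simp

theorem finrank_cycleSpace {p k : ℕ} (hp : 1 < p) :
    Module.finrank ℝ (cycleSpace p k) = (freePositions p k \ borderPositions (p ^ k)).card := by
  have hmem : ∀ R, R ∈ cycleSpace p k ↔ HasPeriodicRowDiffs p k R ∧
      ∀ x ∈ borderPositions (p ^ k), R x.1 x.2 = 0 := by
    intro R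
    rw [← cycleConstraint_iff_hasPeriodicRowDiffs (by omega)]
    simp only [borderPositions, Finset.mem_filter, Finset.mem_univ, true_and, Prod.forall]
    rfl
  refine finrank_eq_card_of_existsUnique_entries _ _ ?_ ?_
  · intro R hR h
    rw [hmem] at hR
    refine hR.1.eq_zero hp fun i l hl => ?_
    by_cases hb : (i, l) ∈ borderPositions (p ^ k)
    · exact hR.2 _ hb
    · exact h (i, l) (Finset.mem_sdiff.2 ⟨by simpa [freePositions] using hl, hb⟩)
  · intro f
    obtain ⟨R, hR, h⟩ := exists_hasPeriodicRowDiffs_extending hp k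
      (fun i l => if hx : i < p ^ k ∧ l < p ^ k then
        (if (⟨i, hx.1⟩, ⟨l, hx.2⟩) ∈ borderPositions (p ^ k) then 0 else
          f (⟨i, hx.1⟩, ⟨l, hx.2⟩)) else 0)
    refine ⟨R, (hmem R).2 ⟨hR, fun x hx => ?_⟩, fun x hx => ?_⟩
    · have hx' := borderPositions_subset_freePositions (by omega) k hx
      rw [h _ _ (by simpa [freePositions] using hx')]
      simp [hx]
    · rw [Finset.mem_sdiff] at hx
      rw [h _ _ (by simpa [freePositions] using hx.1)]
      simp [hx.2]

/-- The primitive `N`-th root of unity `exp (2πi/N)`. -/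
def fourierRoot (N : ℕ) : ℂ := Complex.exp (2 * Real.pi * Complex.I / N)

theorem isPrimitiveRoot_fourierRoot (N : ℕ) [NeZero N] : IsPrimitiveRoot (fourierRoot N) N :=
  Complex.isPrimitiveRoot_exp N (NeZero.ne N)

theorem fourierRoot_ne_zero (N : ℕ) : fourierRoot N ≠ 0 := Complex.exp_ne_zero _

theorem fourierRoot_zpow_eq_zpow {N : ℕ} [NeZero N] {a b : ℤ} (h : a ≡ b [ZMOD N]) :
    fourierRoot N ^ a = fourierRoot N ^ b := by
  have h₁ : fourierRoot N ^ (b - a) = 1 :=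
    ((isPrimitiveRoot_fourierRoot N).zpow_eq_one_iff_dvd _).2 h.dvd
  rw [zpow_sub₀ (fourierRoot_ne_zero N), div_eq_one_iff_eq (zpow_ne_zero _ (fourierRoot_ne_zero N))]
    at h₁
  exact h₁.symm

theorem conj_fourierRoot (N : ℕ) : conj (fourierRoot N) = (fourierRoot N)⁻¹ := by
  rw [fourierRoot, ← Complex.exp_conj, ← Complex.exp_neg]
  congr 1
  simp [neg_div, map_ofNat]

theorem exp_eq_fourierRoot_zpow (N a b : ℕ) :
    Complex.exp (2 * Real.pi * Complex.I * a * b / N) = fourierRoot N ^ ((a : ℤ) * b) := by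
  rw [fourierRoot, ← Complex.exp_int_mul]
  congr 1
  push_cast
  ring

theorem fourierRoot_mul_conj (N a b c : ℕ) :
    fourierRoot N ^ ((a : ℤ) * c) * conj (fourierRoot N ^ ((b : ℤ) * c)) =
      fourierRoot N ^ (((a : ℤ) - b) * c) := by
  rw [map_zpow₀, conj_fourierRoot, _root_.inv_zpow', ← zpow_add₀ (fourierRoot_ne_zero N)]
  congr 1
  ring

theorem fourierMatrix_mul_conj {N : ℕ} (i j k : Fin N) :
    fourierMatrix N i k * conj (fourierMatrix N j k) =
      fourierRoot N ^ ((((i : ℕ) : ℤ) - (j : ℕ)) * (k : ℕ)) / N := by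
  have hs : (Real.sqrt N : ℂ) * Real.sqrt N = N := by
    rw [← Complex.ofReal_mul, Real.mul_self_sqrt (Nat.cast_nonneg N)]
    simp
  rw [← fourierRoot_mul_conj, ← exp_eq_fourierRoot_zpow, ← exp_eq_fourierRoot_zpow]
  simp only [fourierMatrix, Matrix.of_apply, map_div₀, Complex.conj_ofReal]
  rw [div_mul_div_comm, hs]

/-- A sum of a function which is multiplied by `c ≠ 1` under a permutation vanishes. -/
theorem sum_eq_zero_of_comp_equiv {ι : Type*} [Fintype ι] (σ : ι ≃ ι) (ψ : ι → ℂ) {c : ℂ}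
    (hc : c ≠ 1) (h : ∀ i, ψ (σ i) = c * ψ i) : ∑ i, ψ i = 0 := by
  have h₁ : ∑ i, ψ i = c * ∑ i, ψ i := by
    rw [Finset.mul_sum, ← Equiv.sum_comp σ ψ]
    exact Finset.sum_congr rfl fun i _ => h i
  have h₂ : (1 - c) * ∑ i, ψ i = 0 := by linear_combination h₁
  exact (mul_eq_zero.1 h₂).resolve_left (sub_ne_zero.2 hc.symm)

/-- The frequency-`d` Fourier coefficient of a function with period `q` vanishes unless
`N ∣ d * q`. -/
theorem sum_fourierRoot_mul_eq_zero {N : ℕ} [NeZero N] {q : ℕ} (hq : q ∣ N) {d : ℤ}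
    (hd : ¬(N : ℤ) ∣ d * q) (x : Fin N → ℂ)
    (hx : ∀ l l' : Fin N, (l : ℕ) ≡ l' [MOD q] → x l = x l') :
    ∑ l : Fin N, fourierRoot N ^ (d * (l : ℕ)) * x l = 0 := by
  refine sum_eq_zero_of_comp_equiv (Equiv.addRight (Fin.ofNat N q)) _
    (c := fourierRoot N ^ (d * q)) ?_ fun l => ?_
  · rwa [Ne, (isPrimitiveRoot_fourierRoot N).zpow_eq_one_iff_dvd]
  · have hval : ((l + Fin.ofNat N q : Fin N) : ℕ) ≡ l + q [MOD N] := by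
      rw [Fin.val_add, Fin.val_ofNat]
      exact (Nat.mod_modEq _ _).trans ((Nat.mod_modEq q N).add_left _)
    simp only [Equiv.coe_addRight]
    rw [hx (l + Fin.ofNat N q) l ((hval.of_dvd hq).trans (by simp [Nat.ModEq])), ← mul_assoc,
      ← zpow_add₀ (fourierRoot_ne_zero N)]
    congr 1
    refine fourierRoot_zpow_eq_zpow ?_
    have := ((Int.natCast_modEq_iff).2 hval).mul_left d
    refine this.trans ?_
    push_cast
    rw [mul_add, add_comm]

/-- Fourier inversion on `Fin N`. -/
theorem sum_fourierRoot_mul_sum {N : ℕ} [NeZero N] (x : Fin N → ℂ) (l : Fin N) :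
    ∑ d : Fin N, fourierRoot N ^ (-((d : ℕ) : ℤ) * (l : ℕ)) *
      ∑ j : Fin N, fourierRoot N ^ (((d : ℕ) : ℤ) * (j : ℕ)) * x j = N * x l := by
  simp_rw [Finset.mul_sum]
  rw [Finset.sum_comm]
  have h : ∀ j : Fin N, ∑ d : Fin N, fourierRoot N ^ (-((d : ℕ) : ℤ) * (l : ℕ)) *
      (fourierRoot N ^ (((d : ℕ) : ℤ) * (j : ℕ)) * x j) =
      (∑ d : Fin N, fourierRoot N ^ ((((j : ℕ) : ℤ) - (l : ℕ)) * (d : ℕ)) * 1) * x j := by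
    intro j
    rw [Finset.sum_mul]
    refine Finset.sum_congr rfl fun d _ => ?_
    rw [← mul_assoc, ← zpow_add₀ (fourierRoot_ne_zero N), mul_one]
    congr 2
    ring
  simp_rw [h]
  rw [Finset.sum_eq_single l]
  · simp
  · intro j _ hj
    rw [sum_fourierRoot_mul_eq_zero (one_dvd N) _ (fun _ => 1) fun _ _ _ => rfl, zero_mul]
    intro hdvd
    rw [Nat.cast_one, mul_one] at hdvd
    refine hj (Fin.ext (Nat.ModEq.eq_of_lt_of_lt ?_ j.2 l.2))
    exact ((Nat.modEq_iff_dvd).2 hdvd).symm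
  · simp

theorem exists_modEq_of_ne {p k : ℕ} {i j : Fin (p ^ k)} (hij : i ≠ j) :
    ∃ m < k, (i : ℕ) ≡ j [MOD p ^ m] ∧ ¬(i : ℕ) ≡ j [MOD p ^ (m + 1)] := by
  classical
  have hex : ∃ n, ¬(i : ℕ) ≡ j [MOD p ^ n] :=
    ⟨k, fun h => hij (Fin.ext (Nat.ModEq.eq_of_lt_of_lt h i.2 j.2))⟩
  have h0 : Nat.find hex ≠ 0 := by
    intro h
    refine Nat.find_spec hex ?_
    rw [h, pow_zero]
    exact Nat.modEq_one
  obtain ⟨m, hm⟩ := Nat.exists_eq_succ_of_ne_zero h0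
  have hspec := Nat.find_spec hex
  rw [hm] at hspec
  refine ⟨m, ?_, ?_, hspec⟩
  · have : Nat.find hex ≤ k :=
      Nat.find_min' hex fun h => hij (Fin.ext (Nat.ModEq.eq_of_lt_of_lt h i.2 j.2))
    omega
  · exact not_not.1 (Nat.find_min hex (by omega))

/-- For distinct rows `i`, `j`, the frequency-`(i - j)` Fourier coefficient vanishes for every
function of the row difference. -/
theorem HasPeriodicRowDiffs.sum_eq_zero {p k : ℕ} (hp : 1 < p)
    {R : Matrix (Fin (p ^ k)) (Fin (p ^ k)) ℝ} (hR : HasPeriodicRowDiffs p k R)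
    {i j : Fin (p ^ k)} (hij : i ≠ j) (φ : ℝ → ℂ) :
    ∑ l : Fin (p ^ k), fourierRoot (p ^ k) ^ ((((i : ℕ) : ℤ) - (j : ℕ)) * (l : ℕ)) *
      φ (R i l - R j l) = 0 := by
  have : NeZero (p ^ k) := ⟨by positivity⟩
  obtain ⟨m, hm, hij₁, hij₂⟩ := exists_modEq_of_ne hij
  refine sum_fourierRoot_mul_eq_zero (q := p ^ (k - m - 1)) (pow_dvd_pow p (by omega)) ?_ _
    fun l l' hl => by rw [hR m hm i j l l' hij₁ hl]
  intro hdvd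
  have hpow : ((p ^ k : ℕ) : ℤ) = (p ^ (m + 1) : ℕ) * (p ^ (k - m - 1) : ℕ) := by
    rw [← Nat.cast_mul, ← pow_add]; congr 2; omega
  rw [hpow] at hdvd
  have hdvd' := Int.dvd_of_mul_dvd_mul_right (by positivity) hdvd
  exact hij₂ ((Nat.modEq_iff_dvd).2 hdvd').symm

/-- The Fourier coefficients of the rows of a real matrix. -/
def rowFourier {N : ℕ} (R : Matrix (Fin N) (Fin N) ℝ) (i : Fin N) (d : ℤ) : ℂ :=
  ∑ l : Fin N, fourierRoot N ^ (d * (l : ℕ)) * (R i l : ℂ)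

theorem rowFourier_congr {N : ℕ} [NeZero N] (R : Matrix (Fin N) (Fin N) ℝ) (i : Fin N) {a b : ℤ}
    (h : a ≡ b [ZMOD N]) : rowFourier R i a = rowFourier R i b :=
  Finset.sum_congr rfl fun l _ => by rw [fourierRoot_zpow_eq_zpow (h.mul_right _)]

theorem conj_rowFourier {N : ℕ} (R : Matrix (Fin N) (Fin N) ℝ) (i : Fin N) (d : ℤ) :
    conj (rowFourier R i d) = rowFourier R i (-d) := by
  simp only [rowFourier, map_sum, map_mul, map_zpow₀, conj_fourierRoot, Complex.conj_ofReal,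
    _root_.inv_zpow', neg_mul]

theorem mem_defectSpace_fourierMatrix_iff {N : ℕ} [NeZero N] {R : Matrix (Fin N) (Fin N) ℝ} :
    R ∈ defectSpace (fourierMatrix N) ↔ ∀ i j : Fin N,
      rowFourier R i (((i : ℕ) : ℤ) - (j : ℕ)) = rowFourier R j (((i : ℕ) : ℤ) - (j : ℕ)) := by
  have hN : (N : ℂ) ≠ 0 := Nat.cast_ne_zero.2 (NeZero.ne N)
  have hsum : ∀ i j : Fin N, (∑ k, fourierMatrix N i k * conj (fourierMatrix N j k) *
      ((R i k : ℂ) - (R j k : ℂ)) = 0) ↔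
      rowFourier R i (((i : ℕ) : ℤ) - (j : ℕ)) = rowFourier R j (((i : ℕ) : ℤ) - (j : ℕ)) := by
    intro i j
    have h : ∑ k, fourierMatrix N i k * conj (fourierMatrix N j k) *
        ((R i k : ℂ) - (R j k : ℂ)) = (rowFourier R i (((i : ℕ) : ℤ) - (j : ℕ)) -
          rowFourier R j (((i : ℕ) : ℤ) - (j : ℕ))) / N := by
      rw [rowFourier, rowFourier, ← Finset.sum_sub_distrib, Finset.sum_div]
      refine Finset.sum_congr rfl fun k _ => ?_
      rw [fourierMatrix_mul_conj]
      ring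
    rw [h, div_eq_zero_iff, or_iff_left hN, sub_eq_zero]
  change (∀ i j : Fin N, i < j → _) ↔ _
  simp_rw [hsum]
  refine ⟨fun h i j => ?_, fun h i j _ => h i j⟩
  rcases lt_trichotomy i j with hij | hij | hij
  · exact h i j hij
  · rw [hij]
  · have := congrArg conj (h j i hij)
    rw [conj_rowFourier, conj_rowFourier, neg_sub] at this
    exact this.symm

/-- The frequency-`d` coefficients of the rows of an element of the defect space of the Fourier
matrix agree along the multiples of `d`. -/
theorem rowFourier_eq_of_modEq {N : ℕ} [NeZero N] {R : Matrix (Fin N) (Fin N) ℝ}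
    (hR : R ∈ defectSpace (fourierMatrix N)) (d : ℤ) (n : ℕ) {i j : Fin N}
    (hij : ((i : ℕ) : ℤ) - (j : ℕ) ≡ n * d [ZMOD N]) : rowFourier R i d = rowFourier R j d := by
  rw [mem_defectSpace_fourierMatrix_iff] at hR
  induction n generalizing j with
  | zero =>
    have : i = j := by
      refine Fin.ext (Nat.ModEq.eq_of_lt_of_lt ?_ i.2 j.2)
      refine ((Nat.modEq_iff_dvd).2 ?_).symm
      have := hij.symm.dvd
      simpa using this
    rw [this]
  | succ n ih =>
    have hN : (0 : ℤ) < N := by exact_mod_cast NeZero.pos N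
    let j' : Fin N := ⟨((((j : ℕ) : ℤ) + d) % N).toNat, by
      have := Int.emod_lt_of_pos (((j : ℕ) : ℤ) + d) hN
      have := Int.emod_nonneg (((j : ℕ) : ℤ) + d) hN.ne'
      omega⟩
    have hj' : ((j' : ℕ) : ℤ) ≡ (j : ℕ) + d [ZMOD N] := by
      change ((((((j : ℕ) : ℤ) + d) % N).toNat : ℕ) : ℤ) ≡ _ [ZMOD N]
      rw [Int.toNat_of_nonneg (Int.emod_nonneg _ hN.ne')]
      exact Int.mod_modEq _ _
    have h₁ : rowFourier R i d = rowFourier R j' d := by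
      refine ih ?_
      have := hij.add ((Int.ModEq.refl ((j : ℕ) : ℤ)).sub hj')
      push_cast at this
      convert this using 1 <;> ring
    have h₂ : ((j' : ℕ) : ℤ) - (j : ℕ) ≡ d [ZMOD N] := by
      have := hj'.sub_right ((j : ℕ) : ℤ)
      rwa [add_sub_cancel_left] at this
    rw [h₁, ← rowFourier_congr R j' h₂, ← rowFourier_congr R j h₂]
    exact hR j' j

theorem exists_mul_modEq_of_dvd {p : ℕ} (hp : p.Prime) {k m : ℕ} {d a : ℤ}
    (hd : ¬(p : ℤ) ^ (m + 1) ∣ d) (ha : (p : ℤ) ^ m ∣ a) :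
    ∃ n : ℕ, a ≡ n * d [ZMOD (p ^ k : ℕ)] := by
  have hN : (0 : ℤ) < (p ^ k : ℕ) := by exact_mod_cast pow_pos hp.pos k
  have hg : ((Int.gcd d (p ^ k : ℕ) : ℕ) : ℤ) ∣ a := by
    have h₁ : Int.gcd d (p ^ k : ℕ) ∣ p ^ k := by
      exact_mod_cast Int.gcd_dvd_right d (p ^ k : ℕ)
    obtain ⟨v, _, hv⟩ := (Nat.dvd_prime_pow hp).1 h₁
    have hvm : v ≤ m := by
      by_contra hlt
      refine hd ((pow_dvd_pow (p : ℤ) (by omega : m + 1 ≤ v)).trans ?_)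
      have := Int.gcd_dvd_left d (p ^ k : ℕ)
      rw [hv] at this
      exact_mod_cast this
    rw [hv]
    push_cast
    exact (pow_dvd_pow _ hvm).trans ha
  obtain ⟨c, hc⟩ := hg
  rw [Int.gcd_eq_gcd_ab] at hc
  set u := Int.gcdA d (p ^ k : ℕ)
  set w := Int.gcdB d (p ^ k : ℕ)
  refine ⟨(u * c % (p ^ k : ℕ)).toNat, ?_⟩
  rw [Int.toNat_of_nonneg (Int.emod_nonneg _ hN.ne')]
  refine Int.ModEq.trans ?_ ((Int.mod_modEq (u * c) _).symm.mul_right d)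
  refine (Int.modEq_iff_dvd.2 ⟨-(w * c), ?_⟩)
  rw [hc]
  ring

theorem hasPeriodicRowDiffs_of_mem_defectSpace {p k : ℕ} (hp : p.Prime)
    {R : Matrix (Fin (p ^ k)) (Fin (p ^ k)) ℝ}
    (hR : R ∈ defectSpace (fourierMatrix (p ^ k))) : HasPeriodicRowDiffs p k R := by
  have : NeZero (p ^ k) := ⟨(pow_pos hp.pos k).ne'⟩
  intro m hm i j l l' hij hl
  have hdiff : ∀ d : ℤ, ∑ a : Fin (p ^ k), fourierRoot (p ^ k) ^ (d * (a : ℕ)) *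
      ((R i a - R j a : ℝ) : ℂ) = rowFourier R i d - rowFourier R j d := by
    intro d
    rw [rowFourier, rowFourier, ← Finset.sum_sub_distrib]
    refine Finset.sum_congr rfl fun a _ => ?_
    push_cast
    ring
  have hzero : ∀ d : ℤ, ¬(p : ℤ) ^ (m + 1) ∣ d → rowFourier R i d - rowFourier R j d = 0 := by
    intro d hd
    have ha : (p : ℤ) ^ m ∣ ((i : ℕ) : ℤ) - (j : ℕ) := by
      exact_mod_cast (Nat.modEq_iff_dvd).1 hij.symm
    obtain ⟨n, hn⟩ := exists_mul_modEq_of_dvd hp (k := k) hd ha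
    rw [rowFourier_eq_of_modEq hR d n hn, sub_self]
  have hN : ((p ^ k : ℕ) : ℂ) ≠ 0 := Nat.cast_ne_zero.2 (NeZero.ne _)
  have hl₁ := sum_fourierRoot_mul_sum (fun a => ((R i a - R j a : ℝ) : ℂ)) l
  have hl₂ := sum_fourierRoot_mul_sum (fun a => ((R i a - R j a : ℝ) : ℂ)) l'
  have key : ((p ^ k : ℕ) : ℂ) * ((R i l - R j l : ℝ) : ℂ) =
      ((p ^ k : ℕ) : ℂ) * ((R i l' - R j l' : ℝ) : ℂ) := by
    rw [← hl₁, ← hl₂]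
    refine Finset.sum_congr rfl fun d _ => ?_
    rw [hdiff]
    by_cases hd : (p : ℤ) ^ (m + 1) ∣ ((d : ℕ) : ℤ)
    · congr 1
      refine fourierRoot_zpow_eq_zpow (Int.modEq_iff_dvd.2 ?_)
      have hpow : ((p ^ k : ℕ) : ℤ) = (p : ℤ) ^ (m + 1) * ((p ^ (k - m - 1) : ℕ) : ℤ) := by
        push_cast
        rw [← pow_add]; congr 1; omega
      rw [hpow, neg_mul, neg_mul, neg_sub_neg, ← mul_sub]
      exact mul_dvd_mul hd ((Nat.modEq_iff_dvd).1 hl.symm)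
    · rw [hzero _ hd, mul_zero, mul_zero]
  exact Complex.ofReal_injective (mul_left_cancel₀ hN key)

theorem mem_defectSpace_iff_hasPeriodicRowDiffs {p k : ℕ} (hp : p.Prime)
    {R : Matrix (Fin (p ^ k)) (Fin (p ^ k)) ℝ} :
    R ∈ defectSpace (fourierMatrix (p ^ k)) ↔ HasPeriodicRowDiffs p k R := by
  refine ⟨hasPeriodicRowDiffs_of_mem_defectSpace hp, fun hR i j hij => ?_⟩
  have h := hR.sum_eq_zero hp.one_lt hij.ne (fun x => (x : ℂ) / (p ^ k : ℕ))
  rw [← h]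
  refine Finset.sum_congr rfl fun l _ => ?_
  rw [fourierMatrix_mul_conj]
  push_cast
  ring

theorem HasPeriodicRowDiffs.mem_unitaryGroup {p k : ℕ} (hp : 1 < p)
    {R : Matrix (Fin (p ^ k)) (Fin (p ^ k)) ℝ} (hR : HasPeriodicRowDiffs p k R) :
    (Matrix.of fun a b : Fin (p ^ k) =>
        ((1 / Real.sqrt (p ^ k) : ℝ) : ℂ) *
          Complex.exp (2 * Real.pi * Complex.I * (a : ℕ) * (b : ℕ) / (p ^ k : ℕ)) *
          Complex.exp (Complex.I * (R a b : ℝ)))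
      ∈ Matrix.unitaryGroup (Fin (p ^ k)) ℂ := by
  have hs : ((1 / Real.sqrt (p ^ k) : ℝ) : ℂ) * ((1 / Real.sqrt (p ^ k) : ℝ) : ℂ) =
      1 / (p ^ k : ℕ) := by
    rw [← Complex.ofReal_mul, div_mul_div_comm, Real.mul_self_sqrt (by positivity)]
    simp
  rw [Matrix.mem_unitaryGroup_iff]
  ext i j
  rw [Matrix.mul_apply]
  have hterm : ∀ l, (Matrix.of fun a b : Fin (p ^ k) =>
        ((1 / Real.sqrt (p ^ k) : ℝ) : ℂ) *
          Complex.exp (2 * Real.pi * Complex.I * (a : ℕ) * (b : ℕ) / (p ^ k : ℕ)) *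
          Complex.exp (Complex.I * (R a b : ℝ))) i l *
      (star (Matrix.of fun a b : Fin (p ^ k) =>
        ((1 / Real.sqrt (p ^ k) : ℝ) : ℂ) *
          Complex.exp (2 * Real.pi * Complex.I * (a : ℕ) * (b : ℕ) / (p ^ k : ℕ)) *
          Complex.exp (Complex.I * (R a b : ℝ)))) l j =
      fourierRoot (p ^ k) ^ ((((i : ℕ) : ℤ) - (j : ℕ)) * (l : ℕ)) *
        (Complex.exp (Complex.I * (R i l - R j l : ℝ)) * (1 / (p ^ k : ℕ))) := by
    intro l
    have hexp : Complex.exp (Complex.I * (R i l - R j l : ℝ)) =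
        Complex.exp (Complex.I * (R i l : ℝ)) * conj (Complex.exp (Complex.I * (R j l : ℝ))) := by
      rw [← Complex.exp_conj, ← Complex.exp_add]
      congr 1
      simp
      ring
    rw [← fourierRoot_mul_conj, hexp, ← hs]
    simp only [exp_eq_fourierRoot_zpow, Matrix.star_apply, Matrix.of_apply, RCLike.star_def,
      map_mul, Complex.conj_ofReal]
    ring
  rw [Finset.sum_congr rfl fun l _ => hterm l]
  by_cases hij : i = j
  · subst hij
    have : ((p : ℂ) ^ k) ≠ 0 := by
      have : (p : ℂ) ≠ 0 := by exact_mod_cast (by omega : p ≠ 0)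
      positivity
    simp [this]
  · rw [Matrix.one_apply_ne hij]
    exact hR.sum_eq_zero hp hij fun x => Complex.exp (Complex.I * x) * (1 / (p ^ k : ℕ))

/-- For `p` prime, `k > 1`, `N = p^k`: every real matrix `R` satisfying the cycle constraints
yields a unitary complex Hadamard matrix `H_{a,b} = (1/√N)·exp(2πi·a·b/N)·exp(i·R_{a,b})`;
moreover, the space of such `R` that are in addition dephased has dimension
`p^{k-1}((p-1)k - p) + 1`, which equals `d(F_{p^k})`. -/
theorem fourier_prime_power_orbit (p k : ℕ) (hp : p.Prime) (hk : 1 < k) :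
    (∀ R : Matrix (Fin (p ^ k)) (Fin (p ^ k)) ℝ, cycleConstraint p k R →
      (Matrix.of fun a b : Fin (p ^ k) =>
          ((1 / Real.sqrt (p ^ k) : ℝ) : ℂ) *
            Complex.exp (2 * Real.pi * Complex.I * (a : ℕ) * (b : ℕ) / (p ^ k : ℕ)) *
            Complex.exp (Complex.I * (R a b : ℝ)))
        ∈ Matrix.unitaryGroup (Fin (p ^ k)) ℂ) ∧
    Module.finrank ℝ (cycleSpace p k) = p ^ (k - 1) * ((p - 1) * k - p) + 1 ∧
    Module.finrank ℝ (cycleSpace p k) = defect (fourierMatrix (p ^ k)) := by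
  have hp1 := hp.one_lt
  have hcard : Module.finrank ℝ (cycleSpace p k) =
      (freePositions p k).card - (2 * p ^ k - 1) := by
    rw [finrank_cycleSpace hp1, Finset.card_sdiff_of_subset
      (borderPositions_subset_freePositions hp.pos k), card_borderPositions]
  refine ⟨fun R hR => (hR.hasPeriodicRowDiffs hp.pos).mem_unitaryGroup hp1, ?_, ?_⟩
  · rw [hcard, card_freePositions hp1]
    obtain ⟨q, rfl⟩ : ∃ q, p = q + 1 := ⟨p - 1, by omega⟩
    obtain ⟨n, rfl⟩ : ∃ n, k = n + 1 := ⟨k - 1, by omega⟩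
    obtain ⟨r, hr⟩ : ∃ r, q * (n + 1) = r + (q + 1) :=
      ⟨q * (n + 1) - (q + 1), by
        have : q * 2 ≤ q * (n + 1) := Nat.mul_le_mul_left q (by omega)
        omega⟩
    have hP : 0 < (q + 1) ^ n := by positivity
    rw [Nat.add_sub_cancel, Nat.add_sub_cancel, hr, Nat.add_sub_cancel, pow_succ,
      ← mul_assoc, mul_comm (n + 1) q, hr]
    generalize (q + 1) ^ n = P at hP ⊢
    have h₁ : (r + (q + 1)) * P = P * r + P * (q + 1) := by ring
    have h₂ : 0 < P * (q + 1) := by positivity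
    omega
  · rw [hcard, defect, finrank_eq_card_freePositions hp1 _
      fun R => mem_defectSpace_iff_hasPeriodicRowDiffs hp]

end
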